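/- Let L be a join-semilattice with finite connected decompositions and let (A, B) be a finite duality in L with B nonempty. Then for every transversal M of A, the pair (M, {r(M)}) is a finite duality in L. -/

import Mathlib

open Set

/-- `upSet M = {x | ∃ m ∈ M, m ≤ x}`. -/
def upSet {L : Type*} [Preorder L] (M : Set L) : Set L := {x | ∃ m ∈ M, m ≤ x}

/-- `downSet M = {x | ∃ m ∈ M, x ≤ m}`. -/
def downSet {L : Type*} [Preorder L] (M : Set L) : Set L := {x | ∃ m ∈ M, x ≤ m}

/-- A finite duality `(A, B)`: finite antichains such that
`x ∈ ↑A` iff `x ∉ ↓B`. -/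
def FiniteDuality {L : Type*} [Preorder L] (A B : Set L) : Prop :=
  A.Finite ∧ B.Finite ∧ IsAntichain (· ≤ ·) A ∧ IsAntichain (· ≤ ·) B ∧
    ∀ x : L, (∃ a ∈ A, a ≤ x) ↔ ¬ ∃ b ∈ B, x ≤ b

/-- `(l, r)` is a duality pair if `¬ l ≤ x ↔ x ≤ r` for all `x`. -/
def DualityPair {L : Type*} [Preorder L] (l r : L) : Prop :=
  ∀ x : L, ¬ l ≤ x ↔ x ≤ r

/-- An element is connected (join-prime) if `a ≤ b ⊔ c` implies `a ≤ b` or `a ≤ c`. -/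
def ConnectedElt {L : Type*} [SemilatticeSup L] (a : L) : Prop :=
  ∀ b c : L, a ≤ b ⊔ c → a ≤ b ∨ a ≤ c

/-- `L` has finite connected decompositions: every element is the supremum of a
finite nonempty set of connected elements. -/
def HasFiniteConnectedDecompositions (L : Type*) [SemilatticeSup L] : Prop :=
  ∀ a : L, ∃ (F : Finset L) (h : F.Nonempty),
    (∀ c ∈ F, ConnectedElt c) ∧ F.sup' h id = a

/-- `c` is a connected component of `a`: `c` is connected and either `c = a` or
there is `b` with `a = b ⊔ c ≠ b`. -/
def IsConnComponent {L : Type*} [SemilatticeSup L] (c a : L) : Prop :=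
  ConnectedElt c ∧ (c = a ∨ ∃ b : L, a = b ⊔ c ∧ b ⊔ c ≠ b)

/-- `connComponents A` is the set of connected components of elements of `A`. -/
def connComponents {L : Type*} [SemilatticeSup L] (A : Set L) : Set L :=
  {c | ∃ a ∈ A, IsConnComponent c a}

/-- A quasitransversal of `A`: an antichain `M ⊆ A_Cn` with `A ⊆ ↑M`. -/
def IsQuasitransversal {L : Type*} [SemilatticeSup L] (M A : Set L) : Prop :=
  M ⊆ connComponents A ∧ IsAntichain (· ≤ ·) M ∧ A ⊆ upSet M

/-- A transversal of `A`: a quasitransversal maximal in the refinement order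
`M ⊴ N ↔ N ⊆ ↑M`. -/
def IsTransversal {L : Type*} [SemilatticeSup L] (M A : Set L) : Prop :=
  IsQuasitransversal M A ∧
    ∀ N : Set L, IsQuasitransversal N A → N ⊆ upSet M → N = M

/-- The set of weak left duals: elements of `A` for some finite duality `(A, B)`
with `B` nonempty. -/
def wld (L : Type*) [Preorder L] : Set L :=
  {a | ∃ A B : Set L, FiniteDuality A B ∧ B.Nonempty ∧ a ∈ A}

/-- The sparse incomparability axiom. -/
def SIA (L : Type*) [Preorder L] : Prop :=
  ∀ (x : L) (M U : Set L), M.Finite → U.Finite →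
    (insert x (upSet U)) ∩ wld L = ∅ →
    ∃ y : L, y ∉ wld L ∧ y ≤ x ∧ y ∉ upSet (insert x U) ∧
      ∀ m ∈ M, (y ≤ m ↔ x ≤ m)

/-- A connected element below a finite supremum is below one of its members. -/
lemma ConnectedElt.exists_le_of_le_sup' {L : Type*} [SemilatticeSup L] {c : L}
    (hc : ConnectedElt c) {F : Finset L} (hF : F.Nonempty) (h : c ≤ F.sup' hF id) :
    ∃ f ∈ F, c ≤ f := by
  induction hF using Finset.Nonempty.cons_induction with
  | singleton a => exact ⟨a, by simp, by simpa using h⟩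
  | cons a s ha hs ih =>
    rw [Finset.sup'_cons hs] at h
    rcases hc _ _ h with h | h
    · exact ⟨a, by simp, h⟩
    · obtain ⟨f, hf, hcf⟩ := ih h
      exact ⟨f, by simp [hf], hcf⟩

/-- Every connected component of `a` occurs in every finite connected decomposition of `a`. -/
lemma IsConnComponent.mem_of_sup'_eq {L : Type*} [SemilatticeSup L] {c a : L}
    (hc : IsConnComponent c a) {F : Finset L} (hF : F.Nonempty)
    (hconn : ∀ f ∈ F, ConnectedElt f) (hsup : F.sup' hF id = a) : c ∈ F := by
  obtain ⟨hcc, hca⟩ := hc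
  have hle : c ≤ a := by
    rcases hca with rfl | ⟨b, rfl, -⟩
    · exact le_rfl
    · exact le_sup_right
  obtain ⟨f, hf, hcf⟩ := hcc.exists_le_of_le_sup' hF (hle.trans hsup.ge)
  have hfa : f ≤ a := hsup ▸ Finset.le_sup' id hf
  have hfc : f ≤ c := by
    rcases hca with rfl | ⟨b, rfl, hne⟩
    · exact hfa
    · rcases hconn f hf _ _ hfa with h | h
      · exact absurd (sup_eq_left.mpr (hcf.trans h)) hne
      · exact h
  exact le_antisymm hcf hfc ▸ hf

lemma finite_connComponents {L : Type*} [SemilatticeSup L]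
    (hL : HasFiniteConnectedDecompositions L) {A : Set L} (hA : A.Finite) :
    (connComponents A).Finite := by
  have hEq : connComponents A = ⋃ a ∈ A, {c | IsConnComponent c a} := by
    ext c
    simp [connComponents]
  rw [hEq]
  refine hA.biUnion fun a _ => ?_
  obtain ⟨F, hF, hconn, hsup⟩ := hL a
  exact F.finite_toSet.subset fun c hc => hc.mem_of_sup'_eq hF hconn hsup

/-- for every transversal `M` of a finite duality `(A, B)` with
`B` nonempty, the pair `(M, {r(M)})` is a finite duality. -/
theorem transversal_duality {L : Type*} [SemilatticeSup L]
    (hL : HasFiniteConnectedDecompositions L) (A B M : Set L)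
    (hAB : FiniteDuality A B) (hB : B.Nonempty) (hM : IsTransversal M A)
    (r : L) (hr : r ∈ B) (hr1 : M ∩ downSet {r} = ∅)
    (hr2 : connComponents A \ upSet M ⊆ downSet {r}) :
    FiniteDuality M {r} := by
  obtain ⟨hAfin, -, -, hBanti, hdual⟩ := hAB
  obtain ⟨⟨hMsub, hManti, hAM⟩, -⟩ := hM
  have hMr : ∀ m ∈ M, ¬ m ≤ r := fun m hm hmr =>
    (Set.ext_iff.mp hr1 m).mp ⟨hm, r, rfl, hmr⟩
  refine ⟨(finite_connComponents hL hAfin).subset hMsub, finite_singleton r, hManti,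
    IsAntichain.singleton, fun x => ⟨?_, fun hx => ?_⟩⟩
  · rintro ⟨m, hm, hmx⟩ ⟨b, rfl, hxb⟩
    exact hMr m hm (hmx.trans hxb)
  · by_contra hxM
    have hnot : ¬ ∃ a ∈ A, a ≤ x ⊔ r := by
      rintro ⟨a, ha, hax⟩
      obtain ⟨m, hm, hma⟩ := hAM ha
      obtain ⟨_, -, hconn, -⟩ := hMsub hm
      rcases hconn _ _ (hma.trans hax) with h | h
      · exact hxM ⟨m, hm, h⟩
      · exact hMr m hm h
    rw [hdual, not_not] at hnot
    obtain ⟨b, hb, hxb⟩ := hnot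
    have hrb : r = b := hBanti.eq hr hb (le_sup_right.trans hxb)
    exact hx ⟨r, rfl, hrb ▸ le_sup_left.trans hxb⟩
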